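/- Let n ≥ 1 and n < p < +∞. If θ : [0, +∞) → [0, +∞) satisfies, for every smooth function u : ℝⁿ → ℝ with ∫_{ℝⁿ₊} ‖Du(z)‖^p zₙ^{p−n} dz < +∞ and for all x, y ∈ ℝⁿ₊, the estimate |u(x) − u(y)| ≤ θ(d_ℍ(x,y)) · ( ∫_{ℝⁿ₊} ‖Du(z)‖^p zₙ^{p−n} dz )^{1/p}, then there exists a constant C > 0 such that for all t > 0, θ(t) ≥ C · max( t^{1 − n/p}, t^{1 − 1/p} ). -/

import Mathlib

open MeasureTheory Real Set
open scoped ENNReal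

noncomputable section

/-- The last coordinate `xₙ` of a point of `ℝⁿ`. -/
def lastCoord (n : ℕ) (x : EuclideanSpace ℝ (Fin n)) : ℝ :=
  if h : 0 < n then x ⟨n - 1, Nat.sub_lt h one_pos⟩ else 0

/-- The open upper half-space `ℝⁿ₊`. -/
def upperHalf (n : ℕ) : Set (EuclideanSpace ℝ (Fin n)) :=
  {z | 0 < lastCoord n z}

/-- The weighted energy `E_γ(u) = ∫_{ℝⁿ₊} ‖Du(z)‖^p zₙ^γ dz`, as a value in `[0, +∞]`. -/
def energy (n : ℕ) (γ p : ℝ) (u : EuclideanSpace ℝ (Fin n) → ℝ) : ℝ≥0∞ :=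
  ∫⁻ z in upperHalf n, ENNReal.ofReal (‖fderiv ℝ u z‖ ^ p * lastCoord n z ^ γ)

/-- The hyperbolic distance on the Poincaré half-space model. -/
def hypDist (n : ℕ) (x y : EuclideanSpace ℝ (Fin n)) : ℝ :=
  2 * Real.arsinh (‖x - y‖ / (2 * Real.sqrt (lastCoord n x * lastCoord n y)))

lemma continuous_lastCoord (n : ℕ) : Continuous (lastCoord n) := by
  unfold lastCoord
  split_ifs with h
  · fun_prop
  · exact continuous_const

lemma measurableSet_upperHalf (n : ℕ) : MeasurableSet (upperHalf n) :=
  (isOpen_lt continuous_const (continuous_lastCoord n)).measurableSet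

lemma lastCoord_le_norm (n : ℕ) (z : EuclideanSpace ℝ (Fin n)) : lastCoord n z ≤ ‖z‖ := by
  unfold lastCoord
  split_ifs with h
  · exact (le_abs_self _).trans (PiLp.norm_apply_le z _)
  · exact norm_nonneg z

lemma lastCoord_smul (n : ℕ) (c : ℝ) (z : EuclideanSpace ℝ (Fin n)) :
    lastCoord n (c • z) = c * lastCoord n z := by
  unfold lastCoord
  split_ifs <;> simp

lemma exists_norm_eq_one_lastCoord_eq_one {n : ℕ} (hn : 1 ≤ n) :
    ∃ e : EuclideanSpace ℝ (Fin n), ‖e‖ = 1 ∧ lastCoord n e = 1 := by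
  have h : 0 < n := hn
  refine ⟨EuclideanSpace.single ⟨n - 1, Nat.sub_lt h one_pos⟩ 1, by simp, ?_⟩
  simp [lastCoord, h]

lemma hypDist_exp_smul {n : ℕ} {e : EuclideanSpace ℝ (Fin n)} (he : ‖e‖ = 1)
    (he' : lastCoord n e = 1) {t : ℝ} (ht : 0 ≤ t) : hypDist n e (exp t • e) = t := by
  have h1 : e - exp t • e = (1 - exp t) • e := by rw [sub_smul, one_smul]
  have h2 : ‖e - exp t • e‖ = exp t - 1 := by
    rw [h1, norm_smul, he, mul_one, Real.norm_eq_abs, abs_sub_comm, abs_of_nonneg]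
    linarith [Real.one_le_exp ht]
  have h3 : exp t = exp (t / 2) * exp (t / 2) := by rw [← Real.exp_add]; ring_nf
  have h4 : (exp t - 1) / (2 * √(1 * (exp t * 1))) = sinh (t / 2) := by
    rw [one_mul, mul_one, h3, Real.sqrt_mul_self (exp_pos _).le, Real.sinh_eq, Real.exp_neg]
    field_simp
  rw [hypDist, lastCoord_smul, he', h2, h4, Real.arsinh_sinh]
  ring

/-- A bump function of radius `r ≤ 1` at a unit vector has energy at most of order `r ^ (n - p)`. -/
lemma exists_bump_energy_le (n : ℕ) {p : ℝ} (hp : 0 < p) (hnp : (n : ℝ) < p) :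
    ∃ A : ℝ, 0 < A ∧ ∀ e : EuclideanSpace ℝ (Fin n), ‖e‖ = 1 → ∀ r : ℝ, 0 < r → r ≤ 1 →
      ∃ u : EuclideanSpace ℝ (Fin n) → ℝ, ContDiff ℝ (⊤ : ℕ∞) u ∧ u e = 1 ∧
        (∀ z, r ≤ ‖z - e‖ → u z = 0) ∧
        energy n (p - n) p u ≤ ENNReal.ofReal (A * r ^ ((n : ℝ) - p)) := by
  let χ : ContDiffBump (0 : EuclideanSpace ℝ (Fin n)) := ⟨1 / 2, 1, by norm_num, by norm_num⟩
  have hχ : ContDiff ℝ (⊤ : ℕ∞) χ := χ.contDiff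
  obtain ⟨K, hK⟩ := hχ.lipschitzWith_of_hasCompactSupport χ.hasCompactSupport (by simp)
  set V := volume.real (Metric.ball (0 : EuclideanSpace ℝ (Fin n)) 1)
  have hV : 0 ≤ V := measureReal_nonneg
  refine ⟨(K : ℝ) ^ p * 2 ^ (p - n) * V + 1, by positivity, fun e he r hr hr1 => ?_⟩
  let u : EuclideanSpace ℝ (Fin n) → ℝ := fun z => χ (r⁻¹ • (z - e))
  have hu0 : ∀ z, r ≤ ‖z - e‖ → u z = 0 := by
    intro z hz
    refine χ.zero_of_le_dist ?_
    rw [dist_zero_right, norm_smul, norm_inv, Real.norm_of_nonneg hr.le]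
    change 1 ≤ _
    rw [← div_eq_inv_mul, one_le_div hr]
    exact hz
  have hLip : LipschitzWith (K * ‖r⁻¹‖₊) u := by
    refine LipschitzWith.of_dist_le_mul fun z w => (hK.dist_le_mul _ _).trans (le_of_eq ?_)
    rw [dist_smul₀, dist_sub_right, NNReal.coe_mul, coe_nnnorm, mul_assoc]
  have hD : ∀ z, ‖fderiv ℝ u z‖ ≤ K * r⁻¹ := by
    intro z
    have := norm_fderiv_le_of_lipschitz ℝ hLip (x₀ := z)
    rwa [NNReal.coe_mul, coe_nnnorm, Real.norm_of_nonneg (inv_nonneg.2 hr.le)] at this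
  have hD0 : ∀ z, z ∉ Metric.closedBall e r → fderiv ℝ u z = 0 := by
    intro z hz
    have : u =ᶠ[nhds z] fun _ => (0 : ℝ) := by
      filter_upwards [Metric.isClosed_closedBall.isOpen_compl.mem_nhds hz] with w hw
      refine hu0 w ?_
      simp only [mem_compl_iff, Metric.mem_closedBall, not_le, dist_eq_norm] at hw
      exact hw.le
    rw [this.fderiv_eq]
    simp
  refine ⟨u, ?_, ?_, hu0, ?_⟩
  · exact hχ.comp ((contDiff_id.sub contDiff_const).const_smul r⁻¹)
  · exact χ.one_of_mem_closedBall (by simpa using χ.rIn_pos.le)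
  set c : ℝ := ((K : ℝ) * r⁻¹) ^ p * 2 ^ (p - n) with hc
  have hc0 : 0 ≤ c := by positivity
  calc energy n (p - n) p u
      ≤ ∫⁻ z in upperHalf n, (Metric.closedBall e r).indicator (fun _ => ENNReal.ofReal c) z := by
        refine setLIntegral_mono' (measurableSet_upperHalf n) fun z hz => ?_
        have hz0 : 0 < lastCoord n z := hz
        by_cases hze : z ∈ Metric.closedBall e r
        · rw [indicator_of_mem hze]
          refine ENNReal.ofReal_le_ofReal ?_
          have hz2 : lastCoord n z ≤ 2 := by
            have h1 := lastCoord_le_norm n z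
            have h2 : ‖z‖ ≤ ‖z - e‖ + ‖e‖ := norm_le_norm_sub_add z e
            rw [Metric.mem_closedBall, dist_eq_norm] at hze
            linarith
          exact mul_le_mul (Real.rpow_le_rpow (norm_nonneg _) (hD z) hp.le)
            (Real.rpow_le_rpow hz0.le hz2 (by linarith)) (by positivity) (by positivity)
        · rw [hD0 z hze, norm_zero, Real.zero_rpow hp.ne', zero_mul, ENNReal.ofReal_zero]
          exact zero_le
    _ ≤ ∫⁻ z, (Metric.closedBall e r).indicator (fun _ => ENNReal.ofReal c) z :=
        setLIntegral_le_lintegral _ _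
    _ = ENNReal.ofReal (c * (r ^ n * V)) := by
        rw [lintegral_indicator Metric.isClosed_closedBall.measurableSet, setLIntegral_const,
          Measure.addHaar_closedBall _ _ hr.le, finrank_euclideanSpace_fin,
          ENNReal.ofReal_mul hc0, ENNReal.ofReal_mul (pow_nonneg hr.le n),
          ofReal_measureReal (Metric.isBounded_ball.measure_lt_top.ne)]
    _ ≤ _ := by
        refine ENNReal.ofReal_le_ofReal ?_
        have h1 : c * (r ^ n * V) = (K : ℝ) ^ p * 2 ^ (p - n) * V * r ^ ((n : ℝ) - p) := by
          rw [hc, Real.mul_rpow K.coe_nonneg (by positivity), Real.inv_rpow hr.le, Real.rpow_sub hr,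
            Real.rpow_natCast]
          ring
        rw [h1]
        gcongr
        linarith

/-- The derivative of `ρ ↦ log (1 + ρ²) - log (a + ρ²)` divided by `2 * ρ`. -/
def logSlope (a ρ : ℝ) : ℝ := 1 / (1 + ρ ^ 2) - 1 / (a + ρ ^ 2)

lemma logSlope_nonneg {a : ℝ} (ha : 1 ≤ a) (ρ : ℝ) : 0 ≤ logSlope a ρ := by
  unfold logSlope
  rw [sub_nonneg]
  gcongr

lemma logSlope_mul_sq_le {a : ℝ} (ha : 1 ≤ a) (ρ : ℝ) : logSlope a ρ * ρ ^ 2 ≤ 1 := by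
  have h1 : logSlope a ρ ≤ 1 / (1 + ρ ^ 2) := sub_le_self _ (by positivity)
  calc logSlope a ρ * ρ ^ 2 ≤ 1 / (1 + ρ ^ 2) * ρ ^ 2 := by gcongr
    _ ≤ 1 := by rw [div_mul_eq_mul_div, one_mul, div_le_one (by positivity)]; linarith

lemma hasDerivAt_log_sub_log {a : ℝ} (ha : 1 ≤ a) (ρ : ℝ) :
    HasDerivAt (fun s : ℝ => log (1 + s ^ 2) - log (a + s ^ 2)) (2 * (logSlope a ρ * ρ)) ρ := by
  have h1 : ∀ b : ℝ, 1 ≤ b → HasDerivAt (fun s : ℝ => log (b + s ^ 2)) (2 * ρ / (b + ρ ^ 2)) ρ := by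
    intro b hb
    have := ((hasDerivAt_pow 2 ρ).const_add b).log (by positivity)
    simpa using this
  refine ((h1 1 le_rfl).sub (h1 a ha)).congr_deriv ?_
  unfold logSlope
  ring

lemma tendsto_log_sub_log {a : ℝ} (ha : 1 ≤ a) :
    Filter.Tendsto (fun s : ℝ => log (1 + s ^ 2) - log (a + s ^ 2)) Filter.atTop (nhds 0) := by
  have h1 : Filter.Tendsto (fun s : ℝ => (a - 1) / (a + s ^ 2)) Filter.atTop (nhds 0) :=
    (Filter.tendsto_atTop_add_const_left _ a
      (Filter.tendsto_pow_atTop two_ne_zero)).const_div_atTop _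
  have h2 : Filter.Tendsto (fun s : ℝ => log (1 - (a - 1) / (a + s ^ 2))) Filter.atTop
      (nhds (log (1 - 0))) :=
    (h1.const_sub 1).log (by norm_num)
  rw [sub_zero, Real.log_one] at h2
  refine h2.congr fun s => ?_
  have h3 : 0 < a + s ^ 2 := by positivity
  have h4 : 0 < 1 + s ^ 2 := by positivity
  rw [← Real.log_div h4.ne' h3.ne']
  congr 1
  field_simp
  ring

lemma norm_fderiv_log_sub_log {E : Type*} [NormedAddCommGroup E] [InnerProductSpace ℝ E]
    {a : ℝ} (ha : 1 ≤ a) (z : E) :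
    ‖fderiv ℝ (fun w : E => log (1 + ‖w‖ ^ 2) - log (a + ‖w‖ ^ 2)) z‖ =
      2 * (logSlope a ‖z‖ * ‖z‖) := by
  have h1 : ∀ b : ℝ, 1 ≤ b → HasFDerivAt (fun w : E => log (b + ‖w‖ ^ 2))
      ((b + ‖z‖ ^ 2)⁻¹ • (2 • innerSL ℝ z)) z := fun b hb =>
    ((hasStrictFDerivAt_norm_sq z).hasFDerivAt.const_add b).log (by positivity)
  have h2 := ((h1 1 le_rfl).sub (h1 a ha)).fderiv
  have h3 : fderiv ℝ (fun w : E => log (1 + ‖w‖ ^ 2) - log (a + ‖w‖ ^ 2)) z =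
      (2 * logSlope a ‖z‖) • innerSL ℝ z := by
    refine h2.trans ?_
    ext w
    simp [logSlope]
    ring
  rw [h3, norm_smul, innerSL_apply_norm, Real.norm_of_nonneg]
  · ring
  · exact mul_nonneg zero_le_two (logSlope_nonneg ha _)

/-- The radial functions `log (1 + |z|²) - log (a + |z|²)` have energy at most of order `log a`. -/
lemma exists_log_energy_le {n : ℕ} (hn : 1 ≤ n) {p : ℝ} (hnp : (n : ℝ) < p) :
    ∃ B : ℝ, 0 < B ∧ ∀ a : ℝ, 1 ≤ a →
      energy n (p - n) p (fun z => log (1 + ‖z‖ ^ 2) - log (a + ‖z‖ ^ 2)) ≤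
        ENNReal.ofReal (B * log a) := by
  have hp1 : 1 < p := lt_of_le_of_lt (by exact_mod_cast hn) hnp
  have : NeZero n := ⟨by omega⟩
  set V := volume.real (Metric.ball (0 : EuclideanSpace ℝ (Fin n)) 1)
  have hV : 0 < V := 
    ENNReal.toReal_pos (Metric.measure_ball_pos _ _ one_pos).ne' Metric.isBounded_ball.measure_lt_top.ne
  refine ⟨n * V * 2 ^ (p - 1), by positivity, fun a ha => ?_⟩
  let f : ℝ → ℝ := fun ρ => 2 ^ (p - 1) * (2 * (logSlope a ρ * ρ ^ 2)) / ρ ^ n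
  have hf0 : ∀ ρ, 0 ≤ ρ → 0 ≤ f ρ := fun ρ hρ => by
    have := logSlope_nonneg ha ρ
    positivity
  have hfd : ∀ ρ ∈ Ioi (0 : ℝ), ρ ^ (n - 1) • f ρ = 2 ^ (p - 1) * (2 * (logSlope a ρ * ρ)) := by
    intro ρ hρ
    have hρ0 : ρ ≠ 0 := ne_of_gt hρ
    obtain ⟨m, rfl⟩ : ∃ m, n = m + 1 := ⟨n - 1, by omega⟩
    simp only [f, smul_eq_mul, Nat.add_sub_cancel]
    field_simp
    ring
  have hpos : ∀ ρ ∈ Ioi (0 : ℝ), 0 ≤ 2 * (logSlope a ρ * ρ) := fun ρ hρ => by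
    have := logSlope_nonneg ha ρ
    have : (0 : ℝ) < ρ := hρ
    positivity
  have hint : IntegrableOn (fun ρ => 2 * (logSlope a ρ * ρ)) (Ioi 0) :=
    integrableOn_Ioi_deriv_of_nonneg' (fun ρ _ => hasDerivAt_log_sub_log ha ρ) hpos
      (tendsto_log_sub_log ha)
  have hval : ∫ ρ in Ioi (0 : ℝ), 2 * (logSlope a ρ * ρ) = log a := by
    rw [integral_Ioi_of_hasDerivAt_of_nonneg' (fun ρ _ => hasDerivAt_log_sub_log ha ρ) hpos
      (tendsto_log_sub_log ha)]
    simp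
  have hfint : Integrable (fun z : EuclideanSpace ℝ (Fin n) => f ‖z‖) := by
    rw [integrable_fun_norm_addHaar, finrank_euclideanSpace_fin,
      integrableOn_congr_fun hfd measurableSet_Ioi]
    exact hint.const_mul _
  have hfval : ∫ z : EuclideanSpace ℝ (Fin n), f ‖z‖ = n * V * 2 ^ (p - 1) * log a := by
    rw [integral_fun_norm_addHaar, finrank_euclideanSpace_fin,
      setIntegral_congr_fun measurableSet_Ioi hfd, integral_const_mul, hval, nsmul_eq_mul,
      smul_eq_mul]
    ring
  calc energy n (p - n) p (fun z => log (1 + ‖z‖ ^ 2) - log (a + ‖z‖ ^ 2))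
      ≤ ∫⁻ z in upperHalf n, ENNReal.ofReal (f ‖z‖) := by
        refine setLIntegral_mono' (measurableSet_upperHalf n) fun z hz => ?_
        refine ENNReal.ofReal_le_ofReal ?_
        have hz0 : 0 < lastCoord n z := hz
        have hzn := lastCoord_le_norm n z
        have hρ : 0 < ‖z‖ := hz0.trans_le hzn
        have hs := logSlope_nonneg ha ‖z‖
        have hs1 := logSlope_mul_sq_le ha ‖z‖
        rw [norm_fderiv_log_sub_log ha]
        have hx0 : 0 ≤ 2 * (logSlope a ‖z‖ * ‖z‖ ^ 2) := by positivity
        calc (2 * (logSlope a ‖z‖ * ‖z‖)) ^ p * lastCoord n z ^ (p - n)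
            ≤ (2 * (logSlope a ‖z‖ * ‖z‖)) ^ p * ‖z‖ ^ (p - n) := by
              gcongr
          _ = (2 * (logSlope a ‖z‖ * ‖z‖ ^ 2)) ^ p / ‖z‖ ^ n := by
              rw [Real.rpow_sub hρ, Real.rpow_natCast, ← mul_div_assoc,
                ← Real.mul_rpow (by positivity) hρ.le]
              congr 2
              ring
          _ ≤ f ‖z‖ := by
              have : (2 * (logSlope a ‖z‖ * ‖z‖ ^ 2)) ^ p =
                  (2 * (logSlope a ‖z‖ * ‖z‖ ^ 2)) ^ (p - 1) *
                    (2 * (logSlope a ‖z‖ * ‖z‖ ^ 2)) := by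
                rw [← Real.rpow_add_one' hx0 (by linarith)]
                ring_nf
              rw [this]
              simp only [f]
              gcongr
              linarith
    _ ≤ ∫⁻ z, ENNReal.ofReal (f ‖z‖) := setLIntegral_le_lintegral _ _
    _ = _ := by
        rw [← ofReal_integral_eq_lintegral_ofReal hfint
          (Filter.Eventually.of_forall fun z => hf0 _ (norm_nonneg z)), hfval]

/-- Optimality of the Morrey–Sobolev inequality on the hyperbolic space. -/
theorem hyperbolic_morrey_sobolev_optimal (n : ℕ) (hn : 1 ≤ n) (p : ℝ) (hnp : (n : ℝ) < p)
    (θ : ℝ → ℝ) (hθ : ∀ t, 0 ≤ t → 0 ≤ θ t)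
    (h : ∀ u : EuclideanSpace ℝ (Fin n) → ℝ, ContDiff ℝ (⊤ : ℕ∞) u → energy n (p - n) p u < ⊤ →
      ∀ x ∈ upperHalf n, ∀ y ∈ upperHalf n,
        |u x - u y| ≤ θ (hypDist n x y) * (energy n (p - n) p u).toReal ^ (1 / p)) :
    ∃ C : ℝ, 0 < C ∧
      ∀ t > (0 : ℝ), C * max (t ^ (1 - (n : ℝ) / p)) (t ^ (1 - 1 / p)) ≤ θ t := by
  have hn1 : (1 : ℝ) ≤ n := by exact_mod_cast hn
  have hp : 0 < p := by linarith
  obtain ⟨e, he, he'⟩ := exists_norm_eq_one_lastCoord_eq_one hn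
  obtain ⟨A, hA, hbump⟩ := exists_bump_energy_le n hp hnp
  obtain ⟨B, hB, hlog⟩ := exists_log_energy_le hn hnp
  have key : ∀ (u : EuclideanSpace ℝ (Fin n) → ℝ) (M t : ℝ), ContDiff ℝ (⊤ : ℕ∞) u → 0 ≤ M →
      0 < t → energy n (p - n) p u ≤ ENNReal.ofReal M →
      |u e - u (exp t • e)| ≤ θ t * M ^ (1 / p) := by
    intro u M t hu hM ht hE
    have h1 := h u hu (hE.trans_lt ENNReal.ofReal_lt_top) e (by simp [upperHalf, he'])
      (exp t • e) (by simp [upperHalf, lastCoord_smul, he', exp_pos])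
    rw [hypDist_exp_smul he he' ht.le] at h1
    refine h1.trans (mul_le_mul_of_nonneg_left ?_ (hθ t ht.le))
    exact Real.rpow_le_rpow ENNReal.toReal_nonneg (ENNReal.toReal_le_of_le_ofReal hM hE)
      (by positivity)
  have hsmall : ∀ t, 0 < t → t ≤ 1 → A ^ (-(1 / p)) * t ^ (1 - (n : ℝ) / p) ≤ θ t := by
    intro t ht ht1
    obtain ⟨u, hu, hue, hu0, hE⟩ := hbump e he t ht ht1
    have h1 := key u _ t hu (by positivity) ht hE
    have h2 : t ≤ ‖exp t • e - e‖ := by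
      have : exp t • e - e = (exp t - 1) • e := by rw [sub_smul, one_smul]
      rw [this, norm_smul, he, mul_one]
      exact le_trans (by linarith [Real.add_one_le_exp t]) (le_abs_self _)
    rw [hue, hu0 _ h2, sub_zero, abs_one, Real.mul_rpow hA.le (by positivity),
      ← Real.rpow_mul ht.le] at h1
    calc A ^ (-(1 / p)) * t ^ (1 - (n : ℝ) / p)
        ≤ A ^ (-(1 / p)) * t ^ (1 - (n : ℝ) / p) *
          (θ t * (A ^ (1 / p) * t ^ (((n : ℝ) - p) * (1 / p)))) :=
          le_mul_of_one_le_right (by positivity) h1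
      _ = θ t * (A ^ (-(1 / p)) * A ^ (1 / p)) *
          (t ^ (1 - (n : ℝ) / p) * t ^ (((n : ℝ) - p) * (1 / p))) := by ring
      _ = θ t := by
          rw [← Real.rpow_add hA, ← Real.rpow_add ht]
          have : 1 - (n : ℝ) / p + ((n : ℝ) - p) * (1 / p) = 0 := by field_simp; ring
          rw [this]
          simp
  have hlarge : ∀ t, 1 ≤ t → 1 / 2 * (2 * B) ^ (-(1 / p)) * t ^ (1 - 1 / p) ≤ θ t := by
    intro t ht
    have ht0 : 0 < t := by linarith
    have ha : 1 ≤ exp (2 * t) := Real.one_le_exp (by linarith)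
    have hE := hlog _ ha
    rw [Real.log_exp] at hE
    have hu : ContDiff ℝ (⊤ : ℕ∞) (fun z : EuclideanSpace ℝ (Fin n) =>
        log (1 + ‖z‖ ^ 2) - log (exp (2 * t) + ‖z‖ ^ 2)) :=
      ((contDiff_const.add (contDiff_norm_sq ℝ)).log fun z => by positivity).sub
        ((contDiff_const.add (contDiff_norm_sq ℝ)).log fun z => by positivity)
    have h1 := key _ _ t hu (by positivity) ht0 hE
    have h2 : t / 2 ≤ |(log (1 + ‖e‖ ^ 2) - log (exp (2 * t) + ‖e‖ ^ 2)) -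
        (log (1 + ‖exp t • e‖ ^ 2) - log (exp (2 * t) + ‖exp t • e‖ ^ 2))| := by
      have h3 : ‖exp t • e‖ ^ 2 = exp (2 * t) := by
        rw [norm_smul, he, mul_one, Real.norm_of_nonneg (exp_pos _).le, ← Real.exp_nat_mul]
        norm_num
      have h4 : log (exp (2 * t) + exp (2 * t)) = log 2 + 2 * t := by
        rw [← two_mul, Real.log_mul two_ne_zero (exp_pos _).ne', Real.log_exp]
      have h5 : 2 * t ≤ log (1 + exp (2 * t)) := by
        rw [Real.le_log_iff_exp_le (by positivity)]
        linarith
      have h6 := Real.log_two_lt_d9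
      rw [h3, he, h4, abs_sub_comm, add_comm (exp (2 * t)), one_pow, one_add_one_eq_two]
      exact le_trans (by linarith) (le_abs_self _)
    have h3 := h2.trans h1
    rw [← mul_assoc, mul_comm B, Real.mul_rpow (by positivity) ht0.le] at h3
    calc 1 / 2 * (2 * B) ^ (-(1 / p)) * t ^ (1 - 1 / p)
        = (2 * B) ^ (-(1 / p)) * t ^ (-(1 / p)) * (t / 2) := by
          rw [sub_eq_add_neg, Real.rpow_add ht0, Real.rpow_one]
          ring
      _ ≤ (2 * B) ^ (-(1 / p)) * t ^ (-(1 / p)) * (θ t * ((2 * B) ^ (1 / p) * t ^ (1 / p))) := by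
          gcongr
      _ = θ t * ((2 * B) ^ (-(1 / p)) * (2 * B) ^ (1 / p)) * (t ^ (-(1 / p)) * t ^ (1 / p)) := by
          ring
      _ = θ t := by
          rw [← Real.rpow_add (by positivity), ← Real.rpow_add ht0]
          simp
  have hexp : 1 - (n : ℝ) / p ≤ 1 - 1 / p := by gcongr
  refine ⟨min (A ^ (-(1 / p))) (1 / 2 * (2 * B) ^ (-(1 / p))), by positivity, fun t ht => ?_⟩
  rcases le_total t 1 with ht1 | ht1
  · rw [max_eq_left (Real.rpow_le_rpow_of_exponent_ge ht ht1 hexp)]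
    refine le_trans ?_ (hsmall t ht ht1)
    gcongr
    exact min_le_left _ _
  · rw [max_eq_right (Real.rpow_le_rpow_of_exponent_le ht1 hexp)]
    refine le_trans ?_ (hlarge t ht1)
    gcongr
    exact min_le_right _ _
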